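/- arXiv:1507.01322 — 2 statements merged into one kernel-verified Lean document; each statement's English description precedes it below -/
import Mathlib

section
/- For every n ≥ k one has P_S = Σ_{ℓ ∈ S⊡S} u_{n−k+ℓ} · P_{s_{ℓ+1}⋯s_k}, where the term with ℓ = k uses the empty string and P_∅ = 1. -/
open MeasureTheory ENNReal

def occursAt (S : List Bool) (ω : ℕ → Bool) (n : ℕ) : Prop :=
  S.length ≤ n ∧ ∀ j < S.length, ω (n - S.length + j) = S.getD j false

noncomputable def firstOcc (S : List Bool) (ω : ℕ → Bool) : ℕ∞ :=
  ⨅ (n : ℕ) (_ : occursAt S ω n), (n : ℕ∞)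

noncomputable def renewal (S : List Bool) : ℕ → (ℕ → Bool) → ℕ∞
  | 0, _ => 0
  | m + 1, ω =>
      renewal S m ω + firstOcc S (fun i => ω (i + (renewal S m ω).toNat))

noncomputable def u (μ : Measure (ℕ → Bool)) (S : List Bool) (n : ℕ) : ℝ≥0∞ :=
  if n = 0 then 1 else μ {ω | ∃ m, 1 ≤ m ∧ renewal S m ω = (n : ℕ∞)}

/-- `P_W = p^{#H} q^{#T}`, the probability of generating the string `W`. -/
def strProb (p : ℝ) (W : List Bool) : ℝ :=
  p ^ W.count true * (1 - p) ^ W.count false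

/-- The overlap set `S ⊡ W`: shifts `i` at which the last `i` symbols of `S` equal
the first `i` symbols of `W`. -/
def overlaps (S W : List Bool) : Finset ℕ :=
  (Finset.Icc 1 (min S.length W.length)).filter fun i => S.drop (S.length - i) = W.take i

/-- `W` is read in `ω` from position `r` on. -/
def readsAt (W : List Bool) (r : ℕ) (ω : ℕ → Bool) : Prop :=
  ∀ j < W.length, ω (r + j) = W.getD j false

/-- `r` is a non-overlapping completion time of `S`. -/
def IsCompletion (S : List Bool) (r : ℕ) (ω : ℕ → Bool) : Prop :=
  ∃ m, 1 ≤ m ∧ renewal S m ω = (r : ℕ∞)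

theorem occursAt_add_iff (S : List Bool) (ω : ℕ → Bool) (n : ℕ) :
    occursAt S ω (n + S.length) ↔ readsAt S n ω := by
  simp [occursAt, readsAt]

theorem occursAt.shift {S : List Bool} {ω : ℕ → Bool} {a n : ℕ} (h : occursAt S ω n)
    (ha : a + S.length ≤ n) : occursAt S (fun i => ω (i + a)) (n - a) := by
  refine ⟨by omega, fun j hj => ?_⟩
  rw [← h.2 j hj]
  exact congrArg ω (by omega)

theorem occursAt.of_shift {S : List Bool} {ω : ℕ → Bool} {a n : ℕ}
    (h : occursAt S (fun i => ω (i + a)) n) : occursAt S ω (a + n) := by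
  have hn := h.1
  refine ⟨by omega, fun j hj => ?_⟩
  rw [← h.2 j hj]
  congr 1
  omega

theorem occursAt_congr {S : List Bool} {ω ω' : ℕ → Bool} {n : ℕ} (h : ∀ i < n, ω i = ω' i) :
    occursAt S ω n ↔ occursAt S ω' n := by
  refine and_congr_right fun hn => forall₂_congr fun j hj => ?_
  rw [h _ (by omega)]

theorem firstOcc_le {S : List Bool} {ω : ℕ → Bool} {n : ℕ} (h : occursAt S ω n) :
    firstOcc S ω ≤ n :=
  iInf₂_le n h

theorem length_le_firstOcc (S : List Bool) (ω : ℕ → Bool) : (S.length : ℕ∞) ≤ firstOcc S ω :=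
  le_iInf₂ fun _ h => Nat.cast_le.2 h.1

theorem occursAt_of_firstOcc_eq {S : List Bool} {ω : ℕ → Bool} {n : ℕ}
    (h : firstOcc S ω = n) : occursAt S ω n := by
  by_contra hn
  have hle : ((n + 1 : ℕ) : ℕ∞) ≤ firstOcc S ω := by
    refine le_iInf₂ fun m hm => Nat.cast_le.2 ?_
    have hnm : n ≤ m := Nat.cast_le.1 (h ▸ firstOcc_le hm)
    have : n ≠ m := fun e => hn (e ▸ hm)
    omega
  rw [h, Nat.cast_le] at hle
  omega

theorem firstOcc_eq_of_agree {S : List Bool} {ω ω' : ℕ → Bool} {n : ℕ}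
    (h : firstOcc S ω = n) (hag : ∀ i < n, ω i = ω' i) : firstOcc S ω' = n := by
  refine le_antisymm (firstOcc_le ((occursAt_congr hag).1 (occursAt_of_firstOcc_eq h))) ?_
  refine le_iInf₂ fun m hm => ?_
  by_contra! hlt
  have hmn : m < n := Nat.cast_lt.1 hlt
  have := firstOcc_le ((occursAt_congr fun i hi => hag i (by omega)).2 hm)
  exact absurd (h ▸ this) (not_le.2 hlt)

theorem renewal_succ_eq_coe {S : List Bool} {ω : ℕ → Bool} {m r : ℕ}
    (h : renewal S (m + 1) ω = r) :
    ∃ a c : ℕ, renewal S m ω = a ∧ firstOcc S (fun i => ω (i + a)) = c ∧ a + c = r := by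
  have h' : renewal S m ω + firstOcc S (fun i => ω (i + (renewal S m ω).toNat)) = r := h
  have ha : renewal S m ω ≠ ⊤ := by
    intro e
    simp [e] at h'
  obtain ⟨a, ha⟩ := ENat.ne_top_iff_exists.1 ha
  rw [← ha, ENat.toNat_natCast] at h'
  have hc : firstOcc S (fun i => ω (i + a)) ≠ ⊤ := by
    intro e
    simp [e] at h'
  obtain ⟨c, hc⟩ := ENat.ne_top_iff_exists.1 hc
  rw [← hc] at h'
  exact ⟨a, c, ha.symm, hc.symm, by exact_mod_cast h'⟩

theorem renewal_succ_of_eq_coe {S : List Bool} {ω : ℕ → Bool} {m a : ℕ}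
    (h : renewal S m ω = a) :
    renewal S (m + 1) ω = a + firstOcc S (fun i => ω (i + a)) := by
  rw [renewal, h, ENat.toNat_natCast]

theorem renewal_eq_of_agree {S : List Bool} {ω ω' : ℕ → Bool} {m r : ℕ}
    (h : renewal S m ω = r) (hag : ∀ i < r, ω i = ω' i) : renewal S m ω' = r := by
  induction m generalizing r with
  | zero => exact h
  | succ m ih =>
    obtain ⟨a, c, ha, hc, rfl⟩ := renewal_succ_eq_coe h
    rw [renewal_succ_of_eq_coe (ih ha fun i hi => hag i (by omega)),
      firstOcc_eq_of_agree hc fun i hi => hag _ (by omega), Nat.cast_add]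

theorem renewal_add_length_le (S : List Bool) (ω : ℕ → Bool) (m : ℕ) :
    renewal S m ω + S.length ≤ renewal S (m + 1) ω :=
  add_le_add_right (length_le_firstOcc S _) _

theorem renewal_mono (S : List Bool) (ω : ℕ → Bool) : Monotone fun m => renewal S m ω :=
  monotone_nat_of_le_succ fun _ => le_self_add

theorem le_renewal {S : List Bool} (hS : S ≠ []) (ω : ℕ → Bool) (m : ℕ) :
    (m : ℕ∞) ≤ renewal S m ω := by
  induction m with
  | zero => simp
  | succ m ih =>
    refine le_trans ?_ (renewal_add_length_le S ω m)
    rw [Nat.cast_add]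
    exact add_le_add ih (Nat.cast_le.2 (List.length_pos_iff.2 hS))

theorem IsCompletion.of_agree {S : List Bool} {ω ω' : ℕ → Bool} {r : ℕ}
    (h : IsCompletion S r ω) (hag : ∀ i < r, ω i = ω' i) : IsCompletion S r ω' := by
  obtain ⟨m, hm, h⟩ := h
  exact ⟨m, hm, renewal_eq_of_agree h hag⟩

theorem IsCompletion.occursAt {S : List Bool} {ω : ℕ → Bool} {r : ℕ}
    (h : IsCompletion S r ω) : occursAt S ω r := by
  obtain ⟨_ | m, hm, h⟩ := h
  · omega
  · obtain ⟨a, c, -, hc, rfl⟩ := renewal_succ_eq_coe h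
    exact (occursAt_of_firstOcc_eq hc).of_shift

theorem IsCompletion.add_length_le {S : List Bool} {ω : ℕ → Bool} {r r' : ℕ}
    (h : IsCompletion S r ω) (h' : IsCompletion S r' ω) (hlt : r < r') :
    r + S.length ≤ r' := by
  obtain ⟨m, -, h⟩ := h
  obtain ⟨m', -, h'⟩ := h'
  have hm : m < m' := by
    by_contra! hle
    have : renewal S m' ω ≤ renewal S m ω := renewal_mono S ω hle
    rw [h, h', Nat.cast_le] at this
    omega
  have : renewal S m ω + S.length ≤ renewal S m' ω :=
    (renewal_add_length_le S ω m).trans (renewal_mono S ω hm)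
  rw [h, h'] at this
  exact_mod_cast this

theorem exists_isCompletion_of_readsAt {S : List Bool} (hS : S ≠ []) {ω : ℕ → Bool} {d : ℕ}
    (h : readsAt S d ω) : ∃ ℓ, 1 ≤ ℓ ∧ ℓ ≤ S.length ∧ IsCompletion S (d + ℓ) ω := by
  classical
  have hex : ∃ m, (d : ℕ∞) < renewal S m ω :=
    ⟨d + 1, lt_of_lt_of_le (Nat.cast_lt.2 d.lt_succ_self) (le_renewal hS ω (d + 1))⟩
  have hspec := Nat.find_spec hex
  have hmin := fun m => Nat.find_min (m := m) hex
  cases hm : Nat.find hex with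
  | zero => simp [hm, renewal] at hspec
  | succ m =>
    rw [hm] at hspec
    have hle := not_lt.1 (hmin m (by omega))
    obtain ⟨a, ha⟩ := ENat.ne_top_iff_exists.1 (ne_top_of_le_ne_top (ENat.natCast_ne_top d) hle)
    rw [← ha, Nat.cast_le] at hle
    have hocc := ((occursAt_add_iff S ω d).2 h).shift (a := a) (by omega)
    have hub : renewal S (m + 1) ω ≤ ((d + S.length : ℕ) : ℕ∞) := by
      rw [renewal_succ_of_eq_coe ha.symm]
      refine (add_le_add_right (firstOcc_le hocc) _).trans ?_
      rw [← Nat.cast_add, Nat.cast_le]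
      omega
    obtain ⟨r, hr⟩ := ENat.ne_top_iff_exists.1 (ne_top_of_le_ne_top (ENat.natCast_ne_top _) hub)
    rw [← hr, Nat.cast_le] at hub
    rw [← hr, Nat.cast_lt] at hspec
    refine ⟨r - d, by omega, by omega, m + 1, by omega, ?_⟩
    rw [← hr, Nat.add_sub_cancel' hspec.le]

theorem mem_overlaps_self {S : List Bool} {ℓ : ℕ} :
    ℓ ∈ overlaps S S ↔ 1 ≤ ℓ ∧ ℓ ≤ S.length ∧
      ∀ j < ℓ, S.getD (S.length - ℓ + j) false = S.getD j false := by
  simp only [overlaps, Finset.mem_filter, Finset.mem_Icc, min_self, and_assoc]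
  refine and_congr_right fun _ => and_congr_right fun hle => ?_
  constructor
  · intro h j hj
    have := congrArg (fun l => l.getD j false) h
    simpa [List.getD_eq_getElem?_getD, List.getElem?_drop, List.getElem?_take, hj] using this
  · intro h
    refine List.ext_getElem (by simp; omega) fun j h₁ h₂ => ?_
    simp only [List.length_take] at h₂
    have := h j (by omega)
    rw [List.getD_eq_getElem _ _ (by omega), List.getD_eq_getElem _ _ (by omega)] at this
    simpa using this

theorem mem_overlaps_of_isCompletion {S : List Bool} {ω : ℕ → Bool} {d ℓ : ℕ}
    (h₁ : 1 ≤ ℓ) (h₂ : ℓ ≤ S.length) (hc : IsCompletion S (d + ℓ) ω) (h : readsAt S d ω) :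
    ℓ ∈ overlaps S S := by
  refine mem_overlaps_self.2 ⟨h₁, h₂, fun j hj => ?_⟩
  have hr := hc.occursAt.1
  rw [← hc.occursAt.2 _ (by omega), ← h j (by omega)]
  congr 1
  omega

theorem isCompletion_and_readsAt_iff {S : List Bool} {ω : ℕ → Bool} {d ℓ : ℕ}
    (hℓ : ℓ ∈ overlaps S S) :
    IsCompletion S (d + ℓ) ω ∧ readsAt S d ω ↔
      IsCompletion S (d + ℓ) ω ∧ readsAt (S.drop ℓ) (d + ℓ) ω := by
  obtain ⟨h₁, h₂, hov⟩ := mem_overlaps_self.1 hℓ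
  refine and_congr_right fun hc => ⟨fun h j hj => ?_, fun h j hj => ?_⟩
  · rw [List.length_drop] at hj
    rw [add_assoc, h _ (by omega)]
    simp [List.getD_eq_getElem?_getD]
  · by_cases hjℓ : j < ℓ
    · have hr := hc.occursAt.1
      rw [← hov j hjℓ, ← hc.occursAt.2 _ (by omega)]
      congr 1
      omega
    · have := h (j - ℓ) (by rw [List.length_drop]; omega)
      rw [show d + ℓ + (j - ℓ) = d + j by omega] at this
      rw [this]
      simp [List.getD_eq_getElem?_getD, show ℓ + (j - ℓ) = j by omega]

theorem ofReal_strProb {p : ℝ} (hp0 : 0 < p) (hp1 : p < 1) (W : List Bool) :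
    ENNReal.ofReal (strProb p W) =
      ∏ j ∈ Finset.range W.length,
        (if W.getD j false then ENNReal.ofReal p else ENNReal.ofReal (1 - p)) := by
  induction W with
  | nil => simp [strProb]
  | cons a W ih =>
    have hq : 0 < 1 - p := sub_pos.2 hp1
    rw [List.length_cons, Finset.prod_range_succ']
    simp only [List.getD_cons_succ, List.getD_cons_zero]
    rw [← ih]
    cases a
    · rw [if_neg (by simp), ← ENNReal.ofReal_mul (by unfold strProb; positivity)]
      congr 1
      simp [strProb]
      ring
    · rw [if_pos rfl, ← ENNReal.ofReal_mul (by unfold strProb; positivity)]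
      congr 1
      simp [strProb]
      ring

theorem measurableSet_cylinder_nat (r : ℕ) (b : ℕ → Bool) :
    MeasurableSet {ω : ℕ → Bool | ∀ i < r, ω i = b i} := by
  simp only [Set.ofPred_forall]
  exact MeasurableSet.iInter fun i => MeasurableSet.iInter fun _ =>
    measurableSet_eq_fun (measurable_pi_apply i) measurable_const

theorem measurableSet_readsAt (W : List Bool) (r : ℕ) : MeasurableSet {ω | readsAt W r ω} := by
  simp only [readsAt, Set.ofPred_forall]
  exact MeasurableSet.iInter fun j => MeasurableSet.iInter fun _ =>
    measurableSet_eq_fun (measurable_pi_apply (r + j)) measurable_const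

/-- A set determined by the first `r` coordinates is a finite union of cylinders. -/
theorem eq_biUnion_cylinder {E : Set (ℕ → Bool)} {r : ℕ}
    (hE : ∀ ω ω', ω ∈ E → (∀ i < r, ω i = ω' i) → ω' ∈ E) :
    ∃ (s : Finset (ℕ → Bool)),
      (s : Set (ℕ → Bool)).PairwiseDisjoint (fun b => {ω : ℕ → Bool | ∀ i < r, ω i = b i}) ∧
      E = ⋃ b ∈ s, {ω : ℕ → Bool | ∀ i < r, ω i = b i} := by
  classical
  let ext : (Fin r → Bool) → ℕ → Bool := fun c i => if h : i < r then c ⟨i, h⟩ else false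
  refine ⟨(Finset.univ.image ext).filter (· ∈ E), ?_, ?_⟩
  · intro b hb b' hb' hne
    refine Set.disjoint_left.2 fun ω h h' => hne ?_
    simp only [Finset.coe_filter, Finset.mem_image, Finset.mem_univ, true_and,
      Set.mem_ofPred_eq] at hb hb'
    obtain ⟨⟨c, rfl⟩, -⟩ := hb
    obtain ⟨⟨c', rfl⟩, -⟩ := hb'
    funext i
    by_cases hi : i < r
    · exact (h i hi).symm.trans (h' i hi)
    · simp [ext, hi]
  · ext ω
    simp only [Finset.mem_filter, Finset.mem_image, Finset.mem_univ, true_and, Set.mem_iUnion,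
      Set.mem_ofPred_eq, exists_prop]
    constructor
    · intro hω
      have hag : ∀ i < r, ω i = ext (fun j => ω j) i := fun i hi => by simp [ext, hi]
      exact ⟨ext fun j => ω j, ⟨⟨fun j => ω j, rfl⟩, hE _ _ hω hag⟩, hag⟩
    · rintro ⟨b, ⟨-, hb⟩, hag⟩
      exact hE _ _ hb fun i hi => (hag i hi).symm

theorem measurableSet_of_determined {E : Set (ℕ → Bool)} {r : ℕ}
    (hE : ∀ ω ω', ω ∈ E → (∀ i < r, ω i = ω' i) → ω' ∈ E) : MeasurableSet E := by
  obtain ⟨s, -, rfl⟩ := eq_biUnion_cylinder hE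
  exact s.measurableSet_biUnion fun b _ => measurableSet_cylinder_nat r b

section Bernoulli

variable {p : ℝ} {μ : Measure (ℕ → Bool)}

theorem measure_cylinder_inter_readsAt (hp0 : 0 < p) (hp1 : p < 1)
    (hμ : ∀ (n : ℕ) (b : ℕ → Bool),
      μ {ω | ∀ i < n, ω i = b i}
        = ∏ i ∈ Finset.range n, (if b i then ENNReal.ofReal p else ENNReal.ofReal (1 - p)))
    (r : ℕ) (b : ℕ → Bool) (W : List Bool) :
    μ ({ω | ∀ i < r, ω i = b i} ∩ {ω | readsAt W r ω}) =
      μ {ω | ∀ i < r, ω i = b i} * ENNReal.ofReal (strProb p W) := by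
  let b' : ℕ → Bool := fun i => if i < r then b i else W.getD (i - r) false
  have hset : {ω : ℕ → Bool | ∀ i < r, ω i = b i} ∩ {ω | readsAt W r ω} =
      {ω | ∀ i < r + W.length, ω i = b' i} := by
    ext ω
    simp only [Set.mem_inter_iff, Set.mem_ofPred_eq, readsAt]
    constructor
    · rintro ⟨h, hW⟩ i hi
      by_cases hir : i < r
      · simp [b', hir, h i hir]
      · have := hW (i - r) (by omega)
        rw [Nat.add_sub_cancel' (not_lt.1 hir)] at this
        simp only [b', if_neg hir, this]
    · intro h
      refine ⟨fun i hi => ?_, fun j hj => ?_⟩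
      · simpa [b', hi] using h i (by omega)
      · simpa [b'] using h (r + j) (by omega)
  rw [hset, hμ, hμ, Finset.prod_range_add, ofReal_strProb hp0 hp1]
  congr 1
  · refine Finset.prod_congr rfl fun i hi => ?_
    simp [b', Finset.mem_range.1 hi]
  · refine Finset.prod_congr rfl fun j _ => ?_
    simp [b']

theorem measure_inter_readsAt (hp0 : 0 < p) (hp1 : p < 1)
    (hμ : ∀ (n : ℕ) (b : ℕ → Bool),
      μ {ω | ∀ i < n, ω i = b i}
        = ∏ i ∈ Finset.range n, (if b i then ENNReal.ofReal p else ENNReal.ofReal (1 - p)))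
    {E : Set (ℕ → Bool)} {r : ℕ}
    (hE : ∀ ω ω', ω ∈ E → (∀ i < r, ω i = ω' i) → ω' ∈ E) (W : List Bool) :
    μ (E ∩ {ω | readsAt W r ω}) = μ E * ENNReal.ofReal (strProb p W) := by
  obtain ⟨s, hd, rfl⟩ := eq_biUnion_cylinder hE
  rw [Set.iUnion₂_inter, measure_biUnion_finset
      (fun b hb b' hb' hne => (hd hb hb' hne).mono Set.inter_subset_left Set.inter_subset_left)
      (fun b _ => (measurableSet_cylinder_nat r b).inter (measurableSet_readsAt W r)),
    measure_biUnion_finset hd (fun b _ => measurableSet_cylinder_nat r b), Finset.sum_mul]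
  exact Finset.sum_congr rfl fun b _ => measure_cylinder_inter_readsAt hp0 hp1 hμ r b W

end Bernoulli

theorem stmt2 (p : ℝ) (hp0 : 0 < p) (hp1 : p < 1)
    (μ : Measure (ℕ → Bool)) [IsProbabilityMeasure μ]
    (hμ : ∀ (n : ℕ) (b : ℕ → Bool),
      μ {ω | ∀ i < n, ω i = b i}
        = ∏ i ∈ Finset.range n, (if b i then ENNReal.ofReal p else ENNReal.ofReal (1 - p)))
    (S : List Bool) (hS : S ≠ [])
    (n : ℕ) (hn : S.length ≤ n) :
    ENNReal.ofReal (strProb p S)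
      = ∑ ℓ ∈ overlaps S S,
          u μ S (n - S.length + ℓ) * ENNReal.ofReal (strProb p (S.drop ℓ)) := by
  obtain ⟨d, rfl⟩ := Nat.exists_eq_add_of_le' hn
  rw [Nat.add_sub_cancel]
  have hE : ∀ r (ω ω' : ℕ → Bool), ω ∈ {ω | IsCompletion S r ω} → (∀ i < r, ω i = ω' i) →
      ω' ∈ {ω | IsCompletion S r ω} := fun r ω ω' h hag => IsCompletion.of_agree h hag
  have hA : μ {ω | readsAt S d ω} = ENNReal.ofReal (strProb p S) := by
    simpa using measure_inter_readsAt hp0 hp1 hμ (E := Set.univ) (r := d)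
      (fun _ _ _ _ => Set.mem_univ _) S
  have hunion : {ω | readsAt S d ω} =
      ⋃ ℓ ∈ overlaps S S, {ω | IsCompletion S (d + ℓ) ω} ∩ {ω | readsAt S d ω} := by
    ext ω
    simp only [Set.mem_iUnion, Set.mem_inter_iff, Set.mem_ofPred_eq, exists_prop]
    constructor
    · intro h
      obtain ⟨ℓ, h₁, h₂, hc⟩ := exists_isCompletion_of_readsAt hS h
      exact ⟨ℓ, mem_overlaps_of_isCompletion h₁ h₂ hc h, hc, h⟩
    · rintro ⟨-, -, -, h⟩
      exact h
  rw [← hA, hunion, measure_biUnion_finset]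
  · refine Finset.sum_congr rfl fun ℓ hℓ => ?_
    have hset : {ω | IsCompletion S (d + ℓ) ω} ∩ {ω | readsAt S d ω} =
        {ω | IsCompletion S (d + ℓ) ω} ∩ {ω | readsAt (S.drop ℓ) (d + ℓ) ω} :=
      Set.ext fun ω => isCompletion_and_readsAt_iff hℓ
    have hℓ₁ := (mem_overlaps_self.1 hℓ).1
    rw [hset, measure_inter_readsAt hp0 hp1 hμ (hE _), u, if_neg (by omega)]
    rfl
  · intro ℓ hℓ ℓ' hℓ' hne
    obtain ⟨h₁, h₂, -⟩ := mem_overlaps_self.1 hℓ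
    obtain ⟨h₁', h₂', -⟩ := mem_overlaps_self.1 hℓ'
    refine Set.disjoint_left.2 fun ω h h' => ?_
    rcases lt_or_gt_of_ne hne with hlt | hlt
    · have := IsCompletion.add_length_le h.1 h'.1 (by omega)
      omega
    · have := IsCompletion.add_length_le h'.1 h.1 (by omega)
      omega
  · exact fun ℓ _ => (measurableSet_of_determined (hE _)).inter (measurableSet_readsAt S d)
end

section
/- In the game between S₁ = TTTHTTT and S₂ = TTHTTTTHT, the probability that S₁ wins is (1 − p²q³)/(1 + p²q − p³q³) and the probability that S₂ wins is p²q(1 + q³)/(1 + p²q − p³q³). -/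
open MeasureTheory ENNReal

/-- In the game between `S₁` and `S₂`, `S₁` wins: it occurs ending at some trial `n`
while neither pattern occurs ending at any earlier trial. -/
def winsGame (S₁ S₂ : List Bool) (ω : ℕ → Bool) : Prop :=
  ∃ n, occursAt S₁ ω n ∧ ∀ l < n, ¬ occursAt S₁ ω l ∧ ¬ occursAt S₂ ω l

/-- A set of coin sequences that depends only on the first `n` trials. -/
def PrefixDetermined (n : ℕ) (E : Set (ℕ → Bool)) : Prop :=
  ∀ ω ω' : ℕ → Bool, (∀ i < n, ω i = ω' i) → ω ∈ E → ω' ∈ E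

theorem measurable_prefix (n : ℕ) :
    Measurable (fun (ω : ℕ → Bool) (i : Fin n) => ω i) := by
  fun_prop

theorem PrefixDetermined.measurableSet {n : ℕ} {E : Set (ℕ → Bool)}
    (hE : PrefixDetermined n E) : MeasurableSet E := by
  have h : E = (fun (ω : ℕ → Bool) (i : Fin n) => ω i) ⁻¹'
      ((fun (ω : ℕ → Bool) (i : Fin n) => ω i) '' E) := by
    refine Set.Subset.antisymm (Set.subset_preimage_image _ _) ?_
    rintro ω ⟨ω', hω', h⟩
    exact hE ω' ω (fun i hi => congrFun h ⟨i, hi⟩) hω'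
  rw [h]
  exact measurable_prefix n (Set.toFinite _).measurableSet

theorem PrefixDetermined.inter {n : ℕ} {E F : Set (ℕ → Bool)}
    (hE : PrefixDetermined n E) (hF : PrefixDetermined n F) : PrefixDetermined n (E ∩ F) :=
  fun ω ω' h hω => ⟨hE ω ω' h hω.1, hF ω ω' h hω.2⟩

/-- The probability of a single symbol. -/
noncomputable def symbolWeight (p : ℝ) (b : Bool) : ℝ≥0∞ :=
  if b then ENNReal.ofReal p else ENNReal.ofReal (1 - p)

/-- `μ` gives every cylinder the probability it has under independent `p`-biased trials. -/
def IsBernoulliLaw (p : ℝ) (μ : Measure (ℕ → Bool)) : Prop :=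
  ∀ (n : ℕ) (b : ℕ → Bool),
    μ {ω | ∀ i < n, ω i = b i} = ∏ i ∈ Finset.range n, symbolWeight p (b i)

theorem measure_eq_sum_prefix (μ : Measure (ℕ → Bool)) (n : ℕ) (A : Set (ℕ → Bool)) :
    μ A = ∑ y : Fin n → Bool, μ (A ∩ {ω | ∀ i : Fin n, ω i = y i}) := by
  have hm (y : Fin n → Bool) : MeasurableSet {ω : ℕ → Bool | ∀ i : Fin n, ω i = y i} :=
    PrefixDetermined.measurableSet (n := n)
      fun ω ω' h hω i => (h i i.2).symm.trans (hω i)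
  have h := measure_biUnion_finset (μ := μ.restrict A) (s := Finset.univ)
    (f := fun y : Fin n → Bool => {ω : ℕ → Bool | ∀ i : Fin n, ω i = y i})
    (fun y _ z _ hyz => Set.disjoint_left.2 fun ω hy hz =>
      hyz (funext fun i => (hy i).symm.trans (hz i)))
    (fun y _ => hm y)
  have hU : (⋃ y ∈ (Finset.univ : Finset (Fin n → Bool)),
      {ω : ℕ → Bool | ∀ i : Fin n, ω i = y i}) = Set.univ := by
    refine Set.eq_univ_of_forall fun ω => ?_
    simp only [Finset.mem_univ, Set.iUnion_true, Set.mem_iUnion, Set.mem_ofPred_eq]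
    exact ⟨fun i => ω i, fun _ => rfl⟩
  rw [hU, Measure.restrict_apply_univ] at h
  rw [h]
  refine Finset.sum_congr rfl fun y _ => ?_
  rw [Measure.restrict_apply (hm y), Set.inter_comm]

/-- An event determined by the first `n` trials is independent of the next `k` symbols. -/
theorem IsBernoulliLaw.measure_inter_block {p : ℝ} {μ : Measure (ℕ → Bool)}
    (hμ : IsBernoulliLaw p μ) {n : ℕ} {E : Set (ℕ → Bool)} (hE : PrefixDetermined n E)
    (k : ℕ) (w : ℕ → Bool) :
    μ (E ∩ {ω | ∀ j < k, ω (n + j) = w j})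
      = μ E * ∏ j ∈ Finset.range k, symbolWeight p (w j) := by
  rw [measure_eq_sum_prefix μ n, measure_eq_sum_prefix μ n E, Finset.sum_mul]
  refine Finset.sum_congr rfl fun y _ => ?_
  obtain ⟨b, hb⟩ : ∃ b : ℕ → Bool, b = fun i => if h : i < n then y ⟨i, h⟩ else w (i - n) :=
    ⟨_, rfl⟩
  have hby (i : Fin n) : b i = y i := by simp [hb]
  have hbw (j : ℕ) : b (n + j) = w j := by simp [hb]
  by_cases hbE : b ∈ E
  · have h₁ : E ∩ {ω | ∀ i : Fin n, ω i = y i} = {ω | ∀ i < n, ω i = b i} := by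
      ext ω
      constructor
      · intro h i hi
        exact (h.2 ⟨i, hi⟩).trans (hby ⟨i, hi⟩).symm
      · intro h
        exact ⟨hE b ω (fun i hi => (h i hi).symm) hbE,
          fun i => (h i i.2).trans (hby i)⟩
    have h₂ : E ∩ {ω | ∀ j < k, ω (n + j) = w j} ∩ {ω | ∀ i : Fin n, ω i = y i}
        = {ω | ∀ i < n + k, ω i = b i} := by
      rw [Set.inter_right_comm, h₁]
      ext ω
      constructor
      · rintro ⟨h, h'⟩ i hi
        by_cases hin : i < n
        · exact h i hin
        · obtain ⟨j, rfl⟩ := Nat.exists_eq_add_of_le (not_lt.1 hin)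
          rw [hbw]
          exact h' j (by omega)
      · intro h
        exact ⟨fun i hi => h i (by omega), fun j hj => (h (n + j) (by omega)).trans (hbw j)⟩
    rw [h₁, h₂, hμ, hμ, Finset.prod_range_add]
    simp only [hbw]
  · have h₁ : E ∩ {ω | ∀ i : Fin n, ω i = y i} = ∅ := by
      refine Set.eq_empty_of_forall_notMem fun ω h => hbE ?_
      exact hE ω b (fun i hi => (h.2 ⟨i, hi⟩).trans (hby ⟨i, hi⟩).symm) h.1
    rw [Set.inter_right_comm, h₁]
    simp

theorem occursAt_add_length (T : List Bool) (ω : ℕ → Bool) (n : ℕ) :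
    occursAt T ω (n + T.length) ↔ ∀ j < T.length, ω (n + j) = T.getD j false := by
  simp [occursAt]

theorem prefixDetermined_occursAt (S : List Bool) {l n : ℕ} (h : l ≤ n) :
    PrefixDetermined n {ω | occursAt S ω l} := by
  rintro ω ω' hω ⟨h₁, h₂⟩
  exact ⟨h₁, fun j hj => (hω _ (by omega)).symm.trans (h₂ j hj)⟩

/-- Neither pattern occurs ending before trial `n`. -/
def survival (S T : List Bool) (n : ℕ) : Set (ℕ → Bool) :=
  {ω | ∀ l < n, ¬ occursAt S ω l ∧ ¬ occursAt T ω l}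

/-- `S` wins the game against `T` exactly at trial `n`. -/
def winsAt (S T : List Bool) (n : ℕ) : Set (ℕ → Bool) :=
  {ω | occursAt S ω n} ∩ survival S T n

theorem survival_comm (S T : List Bool) (n : ℕ) : survival S T n = survival T S n := by
  ext ω
  simp only [survival, Set.mem_ofPred_eq, and_comm]

theorem prefixDetermined_survival (S T : List Bool) {m n : ℕ} (h : m ≤ n + 1) :
    PrefixDetermined n (survival S T m) := by
  intro ω ω' hω hs l hl
  exact ⟨fun h' => (hs l hl).1 (prefixDetermined_occursAt S (by omega : l ≤ n) ω' ω
      (fun i hi => (hω i hi).symm) h'),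
    fun h' => (hs l hl).2 (prefixDetermined_occursAt T (by omega : l ≤ n) ω' ω
      (fun i hi => (hω i hi).symm) h')⟩

theorem prefixDetermined_winsAt (S T : List Bool) (n : ℕ) :
    PrefixDetermined n (winsAt S T n) :=
  (prefixDetermined_occursAt S le_rfl).inter (prefixDetermined_survival S T (Nat.le_succ n))

/-- A copy of `S` ending after the first `k` symbols of a copy of `T` agrees with it on the
common trials. -/
def Compat (S T : List Bool) (k : ℕ) : Prop :=
  ∀ i < k, k ≤ i + S.length → S.getD (i + S.length - k) false = T.getD i false

instance (S T : List Bool) (k : ℕ) : Decidable (Compat S T k) := by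
  unfold Compat
  infer_instance

theorem compat_of_occursAt {S T : List Bool} {ω : ℕ → Bool} {n k : ℕ} (hk : k ≤ T.length)
    (hS : occursAt S ω (n + k)) (hT : occursAt T ω (n + T.length)) : Compat S T k := by
  intro i hi hki
  rw [occursAt_add_length] at hT
  rw [← hT i (by omega), ← hS.2 (i + S.length - k) (by omega)]
  congr 1
  have := hS.1
  omega

theorem occursAt_iff_of_compat {S T : List Bool} {ω : ℕ → Bool} {n k : ℕ} (hkT : k ≤ T.length)
    (hkS : k ≤ S.length) (hc : Compat S T k) (hS : occursAt S ω (n + k)) :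
    occursAt T ω (n + T.length) ↔
      ∀ j < T.length - k, ω (n + k + j) = T.getD (k + j) false := by
  rw [occursAt_add_length]
  constructor
  · intro h j hj
    rw [← h (k + j) (by omega), add_assoc]
  · intro h j hj
    by_cases hjk : j < k
    · rw [← hc j hjk (by omega), ← hS.2 (j + S.length - k) (by omega)]
      congr 1
      have := hS.1
      omega
    · obtain ⟨i, rfl⟩ := Nat.exists_eq_add_of_le (not_lt.1 hjk)
      rw [← h i (by omega), add_assoc]

/-- The probability that `T` gets completed after its first `k` symbols, if a copy of `S` just
completed allows these to have occurred. -/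
noncomputable def completionWeight (p : ℝ) (S T : List Bool) (k : ℕ) : ℝ≥0∞ :=
  if Compat S T k then ∏ j ∈ Finset.range (T.length - k), symbolWeight p (T.getD (k + j) false)
  else 0

theorem IsBernoulliLaw.measure_winsAt_inter {p : ℝ} {μ : Measure (ℕ → Bool)}
    (hμ : IsBernoulliLaw p μ) {S T S' : List Bool} {n k : ℕ} (hkT : k ≤ T.length)
    (hk : Compat S T k → k ≤ S.length) :
    μ (winsAt S S' (n + k) ∩ {ω | occursAt T ω (n + T.length)})
      = μ (winsAt S S' (n + k)) * completionWeight p S T k := by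
  unfold completionWeight
  split_ifs with hc
  · rw [← hμ.measure_inter_block (prefixDetermined_winsAt S S' (n + k))]
    congr 1
    ext ω
    exact and_congr_right fun h => occursAt_iff_of_compat hkT (hk hc) hc h.1
  · rw [mul_zero]
    convert measure_empty (μ := μ)
    exact Set.eq_empty_of_forall_notMem fun ω h => hc (compat_of_occursAt hkT h.1.1 h.2)

theorem disjoint_winsAt_of_lt {S T S' T' : List Bool} {m n : ℕ} (hmn : m < n)
    (h : S = S' ∨ S = T') : Disjoint (winsAt S T m) (winsAt S' T' n) := by
  refine Set.disjoint_left.2 fun ω h₁ h₂ => ?_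
  rcases h with rfl | rfl
  · exact (h₂.2 m hmn).1 h₁.1
  · exact (h₂.2 m hmn).2 h₁.1

theorem disjoint_winsAt_self {S T : List Bool} (hST : ¬ Compat S T T.length) (n : ℕ) :
    Disjoint (winsAt S T n) (winsAt T S n) := by
  refine Set.disjoint_left.2 fun ω h₁ h₂ => hST ?_
  obtain ⟨m, rfl⟩ := Nat.exists_eq_add_of_le' h₂.1.1
  exact compat_of_occursAt le_rfl h₁.1 h₂.1

theorem exists_winsAt {S T : List Bool} {ω : ℕ → Bool} {n m : ℕ} (hs : ω ∈ survival S T n)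
    (hm : occursAt S ω m ∨ occursAt T ω m) :
    ∃ l, n ≤ l ∧ l ≤ m ∧ (ω ∈ winsAt S T l ∨ ω ∈ winsAt T S l) := by
  classical
  have hex : ∃ m, occursAt S ω m ∨ occursAt T ω m := ⟨m, hm⟩
  have hmin : ω ∈ survival S T (Nat.find hex) := fun l hl => not_or.1 (Nat.find_min hex hl)
  refine ⟨Nat.find hex, ?_, Nat.find_min' hex hm, ?_⟩
  · by_contra! hlt
    exact (Nat.find_spec hex).elim (hs _ hlt).1 (hs _ hlt).2
  · exact (Nat.find_spec hex).imp (fun h => ⟨h, hmin⟩)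
      (fun h => ⟨h, survival_comm S T _ ▸ hmin⟩)

theorem winsAt_subset_survival (S T : List Bool) {m n : ℕ} (h : m ≤ n) :
    winsAt S T n ⊆ survival S T m :=
  fun _ hω l hl => hω.2 l (hl.trans_le h)

theorem measure_survival_inter {S T : List Bool} (hST : ¬ Compat S T T.length)
    (μ : Measure (ℕ → Bool)) (n : ℕ) :
    μ (survival S T (n + 1) ∩ {ω | occursAt T ω (n + T.length)})
      = ∑ k ∈ Finset.range T.length,
        (μ (winsAt S T (n + (k + 1)) ∩ {ω | occursAt T ω (n + T.length)})
          + μ (winsAt T S (n + (k + 1)) ∩ {ω | occursAt T ω (n + T.length)})) := by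
  have hO := (prefixDetermined_occursAt T (le_refl (n + T.length))).measurableSet
  have hW (S T : List Bool) (m : ℕ) := (prefixDetermined_winsAt S T m).measurableSet
  have hset : survival S T (n + 1) ∩ {ω | occursAt T ω (n + T.length)}
      = ⋃ k ∈ Finset.range T.length, (winsAt S T (n + (k + 1)) ∪ winsAt T S (n + (k + 1)))
          ∩ {ω | occursAt T ω (n + T.length)} := by
    ext ω
    simp only [Set.mem_iUnion, Finset.mem_range, exists_prop]
    constructor
    · rintro ⟨hs, ho⟩
      obtain ⟨l, h₁, h₂, h₃⟩ := exists_winsAt hs (Or.inr ho)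
      obtain ⟨k, rfl⟩ := Nat.exists_eq_add_of_le h₁
      exact ⟨k, by omega, by rwa [add_right_comm, add_assoc] at h₃, ho⟩
    · rintro ⟨k, hk, h, ho⟩
      refine ⟨?_, ho⟩
      rcases h with h | h
      · exact winsAt_subset_survival S T (by omega) h
      · exact survival_comm T S _ ▸ winsAt_subset_survival T S (by omega) h
  rw [hset, measure_biUnion_finset _ fun k _ => ((hW _ _ _).union (hW _ _ _)).inter hO]
  · refine Finset.sum_congr rfl fun k _ => ?_
    rw [Set.union_inter_distrib_right, measure_union _ ((hW _ _ _).inter hO)]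
    exact (disjoint_winsAt_self hST _).mono Set.inter_subset_left Set.inter_subset_left
  · have key : ∀ i j : ℕ, i < j →
        Disjoint ((winsAt S T (n + (i + 1)) ∪ winsAt T S (n + (i + 1)))
            ∩ {ω | occursAt T ω (n + T.length)})
          ((winsAt S T (n + (j + 1)) ∪ winsAt T S (n + (j + 1)))
            ∩ {ω | occursAt T ω (n + T.length)}) := by
      intro i j hij
      refine Disjoint.mono Set.inter_subset_left Set.inter_subset_left ?_
      have hlt : n + (i + 1) < n + (j + 1) := by omega
      simp only [Set.disjoint_union_left, Set.disjoint_union_right]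
      exact ⟨⟨disjoint_winsAt_of_lt hlt (.inl rfl), disjoint_winsAt_of_lt hlt (.inr rfl)⟩,
        ⟨disjoint_winsAt_of_lt hlt (.inr rfl), disjoint_winsAt_of_lt hlt (.inl rfl)⟩⟩
    intro i _ j _ hij
    rcases lt_or_gt_of_ne hij with h | h
    · exact key i j h
    · exact (key j i h).symm

theorem setOf_winsGame (S T : List Bool) : {ω | winsGame S T ω} = ⋃ n, winsAt S T n := by
  ext ω
  simp [winsGame, winsAt, survival]

theorem measure_winsGame (S T : List Bool) (μ : Measure (ℕ → Bool)) :
    μ {ω | winsGame S T ω} = ∑' n, μ (winsAt S T n) := by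
  rw [setOf_winsGame]
  refine measure_iUnion (fun i j hij => ?_)
    fun n => (prefixDetermined_winsAt S T n).measurableSet
  rcases lt_or_gt_of_ne hij with h | h
  · exact disjoint_winsAt_of_lt h (.inl rfl)
  · exact (disjoint_winsAt_of_lt h (.inl rfl)).symm

theorem tsum_measure_winsAt_add (S T : List Bool) (μ : Measure (ℕ → Bool)) {k : ℕ}
    (hk : k ≤ S.length) :
    ∑' n, μ (winsAt S T (n + k)) = μ {ω | winsGame S T ω} := by
  rw [measure_winsGame, ← Summable.sum_add_tsum_nat_add' (f := fun n => μ (winsAt S T n)) (k := k)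
      ENNReal.summable,
    Finset.sum_eq_zero, zero_add]
  intro n hn
  convert measure_empty (μ := μ)
  refine Set.eq_empty_of_forall_notMem fun ω h => ?_
  have := h.1.1
  have := Finset.mem_range.1 hn
  omega

theorem IsBernoulliLaw.tsum_measure_winsAt_inter {p : ℝ} {μ : Measure (ℕ → Bool)}
    (hμ : IsBernoulliLaw p μ) {S T S' : List Bool} {k : ℕ} (hkT : k ≤ T.length)
    (hk : Compat S T k → k ≤ S.length) :
    ∑' n, μ (winsAt S S' (n + k) ∩ {ω | occursAt T ω (n + T.length)})
      = μ {ω | winsGame S S' ω} * completionWeight p S T k := by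
  simp only [hμ.measure_winsAt_inter hkT hk]
  rw [ENNReal.tsum_mul_right]
  by_cases hc : Compat S T k
  · rw [tsum_measure_winsAt_add S S' μ (hk hc)]
  · simp [completionWeight, hc]

/-- The expected duration of the game times the probability of `T`, expressed through the winning
probabilities and the overlaps of the patterns with `T`. -/
theorem IsBernoulliLaw.tsum_measure_survival {p : ℝ} {μ : Measure (ℕ → Bool)}
    (hμ : IsBernoulliLaw p μ) {S T : List Bool} (hST : ¬ Compat S T T.length)
    (hk : ∀ k < T.length, Compat S T (k + 1) → k + 1 ≤ S.length) :
    (∑' n, μ (survival S T (n + 1))) *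
        ∏ j ∈ Finset.range T.length, symbolWeight p (T.getD j false)
      = μ {ω | winsGame S T ω} * ∑ k ∈ Finset.range T.length, completionWeight p S T (k + 1)
        + μ {ω | winsGame T S ω} *
          ∑ k ∈ Finset.range T.length, completionWeight p T T (k + 1) := by
  have h (n : ℕ) : μ (survival S T (n + 1)) *
        ∏ j ∈ Finset.range T.length, symbolWeight p (T.getD j false)
      = μ (survival S T (n + 1) ∩ {ω | occursAt T ω (n + T.length)}) := by
    rw [← hμ.measure_inter_block (prefixDetermined_survival S T le_rfl)]
    simp only [occursAt_add_length]
  rw [← ENNReal.tsum_mul_right]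
  simp only [h, measure_survival_inter hST]
  rw [Summable.tsum_finsetSum fun _ _ => ENNReal.summable, Finset.mul_sum, Finset.mul_sum,
    ← Finset.sum_add_distrib]
  refine Finset.sum_congr rfl fun k hkT => ?_
  rw [Finset.mem_range] at hkT
  rw [ENNReal.tsum_add, hμ.tsum_measure_winsAt_inter hkT (hk k hkT),
    hμ.tsum_measure_winsAt_inter hkT fun _ => hkT]

/-- If the expected duration is finite, then one of the two patterns wins almost surely. -/
theorem measure_winsGame_add {S T : List Bool} (hST : ¬ Compat S T T.length)
    (μ : Measure (ℕ → Bool)) [IsProbabilityMeasure μ]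
    (hfin : ∑' n, μ (survival S T (n + 1)) ≠ ⊤) :
    μ {ω | winsGame S T ω} + μ {ω | winsGame T S ω} = 1 := by
  have hN : μ (⋂ n, survival S T (n + 1)) = 0 := by
    by_contra h0
    refine hfin (top_unique ?_)
    rw [← ENNReal.tsum_const_eq_top_of_ne_zero (α := ℕ) h0]
    exact ENNReal.tsum_le_tsum fun n => measure_mono (Set.iInter_subset _ n)
  have hdisj : Disjoint {ω | winsGame S T ω} {ω | winsGame T S ω} := by
    simp only [setOf_winsGame, Set.disjoint_iUnion_left, Set.disjoint_iUnion_right]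
    intro j i
    rcases lt_trichotomy i j with h | rfl | h
    · exact disjoint_winsAt_of_lt h (.inr rfl)
    · exact disjoint_winsAt_self hST i
    · exact (disjoint_winsAt_of_lt h (.inr rfl)).symm
  have hmeas : MeasurableSet {ω | winsGame T S ω} := by
    rw [setOf_winsGame]
    exact .iUnion fun n => (prefixDetermined_winsAt T S n).measurableSet
  rw [← measure_union hdisj hmeas]
  refine le_antisymm prob_le_one ?_
  have hcov : (Set.univ : Set (ℕ → Bool)) ⊆
      ({ω | winsGame S T ω} ∪ {ω | winsGame T S ω}) ∪ ⋂ n, survival S T (n + 1) := by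
    intro ω _
    by_cases hω : ∃ m, occursAt S ω m ∨ occursAt T ω m
    · obtain ⟨m, hm⟩ := hω
      obtain ⟨l, -, -, h⟩ := exists_winsAt (n := 0) (fun l hl => absurd hl l.not_lt_zero) hm
      rw [setOf_winsGame, setOf_winsGame]
      exact .inl (h.imp (fun h => Set.mem_iUnion.2 ⟨l, h⟩) fun h => Set.mem_iUnion.2 ⟨l, h⟩)
    · push Not at hω
      exact .inr (Set.mem_iInter.2 fun n l _ => hω l)
  calc (1 : ℝ≥0∞) = μ Set.univ := measure_univ.symm
    _ ≤ _ := measure_mono hcov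
    _ ≤ _ := measure_union_le _ _
    _ = _ := by rw [hN, add_zero]

theorem stmt12 (p : ℝ) (hp0 : 0 < p) (hp1 : p < 1)
    (μ : Measure (ℕ → Bool)) [IsProbabilityMeasure μ]
    (hμ : ∀ (n : ℕ) (b : ℕ → Bool),
      μ {ω | ∀ i < n, ω i = b i}
        = ∏ i ∈ Finset.range n, (if b i then ENNReal.ofReal p else ENNReal.ofReal (1 - p))) :
    μ {ω | winsGame [false, false, false, true, false, false, false]
            [false, false, true, false, false, false, false, true, false] ω}
        = ENNReal.ofReal ((1 - p ^ 2 * (1 - p) ^ 3) / (1 + p ^ 2 * (1 - p) - p ^ 3 * (1 - p) ^ 3)) ∧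
    μ {ω | winsGame [false, false, true, false, false, false, false, true, false]
            [false, false, false, true, false, false, false] ω}
        = ENNReal.ofReal (p ^ 2 * (1 - p) * (1 + (1 - p) ^ 3) /
            (1 + p ^ 2 * (1 - p) - p ^ 3 * (1 - p) ^ 3)) := by
  have hlaw : IsBernoulliLaw p μ := hμ
  obtain ⟨S, hS⟩ : ∃ S, S = [false, false, false, true, false, false, false] := ⟨_, rfl⟩
  obtain ⟨T, hT⟩ : ∃ T, T = [false, false, true, false, false, false, false, true, false] :=
    ⟨_, rfl⟩
  rw [← hS, ← hT]
  have hST : ¬ Compat S T T.length := by subst hS hT; decide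
  have hTS : ¬ Compat T S S.length := by subst hS hT; decide
  have e₂ := hlaw.tsum_measure_survival hST (by subst hS hT; decide)
  have e₁ := hlaw.tsum_measure_survival hTS (by subst hS hT; decide)
  simp only [survival_comm T S] at e₁
  obtain ⟨q, hq⟩ : ∃ q, q = 1 - p := ⟨_, rfl⟩
  have hq0 : 0 < q := by linarith
  obtain ⟨P, hP⟩ : ∃ P : NNReal, (P : ℝ) = p := ⟨⟨p, hp0.le⟩, rfl⟩
  obtain ⟨Q, hQ⟩ : ∃ Q : NNReal, (Q : ℝ) = q := ⟨⟨q, hq0.le⟩, rfl⟩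
  have ht : symbolWeight p true = P := by simp [symbolWeight, ← hP]
  have hf : symbolWeight p false = Q := by simp [symbolWeight, ← hq, ← hQ]
  have c₁₁ : ∑ k ∈ Finset.range S.length, completionWeight p S S (k + 1)
      = 1 + P * Q ^ 3 + P * Q ^ 4 + P * Q ^ 5 := by
    subst hS hT
    simp +decide [completionWeight, Finset.sum_range_succ, Finset.prod_range_succ, ht, hf]
    ring
  have c₂₁ : ∑ k ∈ Finset.range S.length, completionWeight p T S (k + 1)
      = Q ^ 2 + P * Q ^ 5 := by
    subst hS hT
    simp +decide [completionWeight, Finset.sum_range_succ, Finset.prod_range_succ, ht, hf]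
    ring
  have c₁₂ : ∑ k ∈ Finset.range T.length, completionWeight p S T (k + 1)
      = P * Q ^ 2 + P ^ 2 * Q ^ 5 + P ^ 2 * Q ^ 6 := by
    subst hS hT
    simp +decide [completionWeight, Finset.sum_range_succ, Finset.prod_range_succ, ht, hf]
    ring
  have c₂₂ : ∑ k ∈ Finset.range T.length, completionWeight p T T (k + 1)
      = 1 + P * Q ^ 4 + P ^ 2 * Q ^ 6 := by
    subst hS hT
    simp +decide [completionWeight, Finset.sum_range_succ, Finset.prod_range_succ, ht, hf]
    ring
  have w₁ : ∏ j ∈ Finset.range S.length, symbolWeight p (S.getD j false) = P * Q ^ 6 := by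
    subst hS hT
    simp [Finset.prod_range_succ, ht, hf]
    ring
  have w₂ : ∏ j ∈ Finset.range T.length, symbolWeight p (T.getD j false) = P ^ 2 * Q ^ 7 := by
    subst hS hT
    simp [Finset.prod_range_succ, ht, hf]
    ring
  rw [c₁₁, c₂₁, w₁] at e₁
  rw [c₁₂, c₂₂, w₂] at e₂
  obtain ⟨a, ha⟩ := ENNReal.canLift.prf _ (measure_ne_top μ {ω | winsGame S T ω})
  obtain ⟨b, hb⟩ := ENNReal.canLift.prf _ (measure_ne_top μ {ω | winsGame T S ω})
  rw [← ha, ← hb] at e₁ e₂ ⊢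
  have hfin : ∑' n, μ (survival S T (n + 1)) ≠ ⊤ := by
    intro h
    have hw : (P * Q ^ 6 : ℝ≥0∞) ≠ 0 := by
      have : (P * Q ^ 6 : ℝ) ≠ 0 := by rw [hP, hQ]; positivity
      exact_mod_cast this
    rw [h, ENNReal.top_mul hw] at e₁
    exact absurd e₁ (by norm_cast)
  have e₀ := measure_winsGame_add hST μ hfin
  obtain ⟨c, hc⟩ := ENNReal.canLift.prf _ hfin
  rw [← ha, ← hb] at e₀
  rw [← hc] at e₁ e₂
  have r₀ : (a + b : ℝ) = 1 := by exact_mod_cast e₀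
  have r₁ : (c * (P * Q ^ 6) : ℝ) = b * (Q ^ 2 + P * Q ^ 5)
      + a * (1 + P * Q ^ 3 + P * Q ^ 4 + P * Q ^ 5) := by exact_mod_cast e₁
  have r₂ : (c * (P ^ 2 * Q ^ 7) : ℝ) = a * (P * Q ^ 2 + P ^ 2 * Q ^ 5 + P ^ 2 * Q ^ 6)
      + b * (1 + P * Q ^ 4 + P ^ 2 * Q ^ 6) := by exact_mod_cast e₂
  rw [hP, hQ] at r₁ r₂
  have hodds : (b : ℝ) * (1 - p ^ 2 * q ^ 3) = a * (p ^ 2 * q * (1 + q ^ 3)) := by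
    subst hq
    linear_combination r₁ * (p * (1 - p)) - r₂
  rw [← hq]
  have hpq : p * q < 1 := by nlinarith
  have hD : 0 < 1 + p ^ 2 * q - p ^ 3 * q ^ 3 := by
    have h₁ : (p * q) ^ 3 < 1 := pow_lt_one₀ (by positivity) hpq (by norm_num)
    have h₂ : 0 < p ^ 2 * q := by positivity
    nlinarith
  have hb' : (b : ℝ) = 1 - a := by linarith
  constructor
  · rw [← ENNReal.ofReal_coe_nnreal]
    congr 1
    rw [eq_div_iff hD.ne']
    subst hq
    rw [hb'] at hodds
    linear_combination -hodds
  · rw [← ENNReal.ofReal_coe_nnreal]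
    congr 1
    rw [eq_div_iff hD.ne']
    have ha' : (a : ℝ) = 1 - b := by linarith
    subst hq
    rw [ha'] at hodds
    linear_combination hodds
end
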